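/- arXiv:2605.23650 — 5 statements merged into one kernel-verified Lean document; each statement's English description precedes it below -/
import Mathlib

section
/- Let H be a real Hilbert space, let Z be a set, let φ : Z → H, and define the kernel k(z, z') = ⟨φ(z), φ(z')⟩. Let v₁, …, vₙ ∈ H, let τ > 0, let K ∈ ℝ^{n×n} be the Gram matrix K_{ij} = ⟨vᵢ, vⱼ⟩, and for z ∈ Z let k̄(z) ∈ ℝⁿ be given by k̄(z)ᵢ = ⟨vᵢ, φ(z)⟩. Define the posterior kernel k_post(z, z') = k(z, z') − k̄(z)ᵀ (K + τ Iₙ)⁻¹ k̄(z'). Then K + τ Iₙ is invertible and for every m ≥ 1, every z₁, …, z_m ∈ Z, and every c ∈ ℝ^m one has 0 ≤ Σ_{i,j} cᵢ cⱼ k_post(zᵢ, zⱼ) ≤ Σ_{i,j} cᵢ cⱼ k(zᵢ, zⱼ); that is, k_post is a positive semidefinite kernel dominated by k in the positive-definite order. -/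
open scoped InnerProductSpace
open Matrix

/-- A regularized Gram matrix is positive definite. -/
lemma posDef_gram_add_smul_one {H ι : Type*} [NormedAddCommGroup H] [InnerProductSpace ℝ H]
    [Fintype ι] [DecidableEq ι] (v : ι → H) {τ : ℝ} (hτ : 0 < τ) :
    (gram ℝ v + τ • (1 : Matrix ι ι ℝ)).PosDef :=
  PosDef.posSemidef_add (posSemidef_gram ℝ v) (PosDef.one.smul hτ)

/-- The squared norm of `h` dominates the quadratic form of the inverse of the regularized Gram
matrix of `v` at the coefficients `⟪v i, h⟫`. -/
lemma dotProduct_inv_gram_add_smul_one_mulVec_le {H ι : Type*} [NormedAddCommGroup H]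
    [InnerProductSpace ℝ H] [Fintype ι] [DecidableEq ι] (v : ι → H) {τ : ℝ} (hτ : 0 < τ) (h : H) :
    (fun i => ⟪v i, h⟫_ℝ) ⬝ᵥ
      ((gram ℝ v + τ • (1 : Matrix ι ι ℝ))⁻¹ *ᵥ fun i => ⟪v i, h⟫_ℝ) ≤ ⟪h, h⟫_ℝ := by
  set A := gram ℝ v + τ • (1 : Matrix ι ι ℝ) with hA
  set b : ι → ℝ := fun i => ⟪v i, h⟫_ℝ with hb
  set a := A⁻¹ *ᵥ b with ha
  set w := ∑ i, a i • v i with hw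
  have hAa : A *ᵥ a = b := by
    rw [ha, mulVec_mulVec, mul_nonsing_inv _
      ((isUnit_iff_isUnit_det A).1 (posDef_gram_add_smul_one v hτ).isUnit), one_mulVec]
  have hwh : ⟪w, h⟫_ℝ = b ⬝ᵥ a := by
    simp [hw, hb, sum_inner, real_inner_smul_left, dotProduct, mul_comm]
  have hww : a ⬝ᵥ (gram ℝ v *ᵥ a) = ⟪w, w⟫_ℝ := by
    simpa using star_dotProduct_gram_mulVec v a a
  have hab : b ⬝ᵥ a = ⟪w, w⟫_ℝ + τ * (a ⬝ᵥ a) := by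
    rw [dotProduct_comm, ← hAa, hA, add_mulVec, dotProduct_add, hww, smul_mulVec, one_mulVec,
      dotProduct_smul, smul_eq_mul]
  have haa : 0 ≤ τ * (a ⬝ᵥ a) :=
    mul_nonneg hτ.le (Finset.sum_nonneg fun i _ => mul_self_nonneg (a i))
  have hsub : 0 ≤ ⟪h - w, h - w⟫_ℝ := real_inner_self_nonneg
  rw [real_inner_sub_sub_self, real_inner_comm w h, hwh] at hsub
  linarith

/-- With `k(z,z') = ⟪φ z, φ z'⟫`, Gram matrix `K` of `v₁, …, vₙ`, `τ > 0`,
`k̄(z)ᵢ = ⟪vᵢ, φ z⟫` and `k_post(z,z') = k(z,z') − k̄(z)ᵀ (K + τ I)⁻¹ k̄(z')`, the matrix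
`K + τ I` is invertible and `k_post` is a positive semidefinite kernel dominated by `k`. -/
theorem statement2 {H Z : Type*} [NormedAddCommGroup H] [InnerProductSpace ℝ H]
    (φ : Z → H) (k : Z → Z → ℝ) (hk : ∀ z z', k z z' = ⟪φ z, φ z'⟫_ℝ)
    {n : ℕ} (v : Fin n → H) (τ : ℝ) (hτ : 0 < τ)
    (K : Matrix (Fin n) (Fin n) ℝ) (hK : ∀ i j, K i j = ⟪v i, v j⟫_ℝ)
    (kbar : Z → Fin n → ℝ) (hkbar : ∀ z i, kbar z i = ⟪v i, φ z⟫_ℝ)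
    (kpost : Z → Z → ℝ)
    (hkpost : ∀ z z', kpost z z' =
      k z z' - kbar z ⬝ᵥ ((K + τ • (1 : Matrix (Fin n) (Fin n) ℝ))⁻¹ *ᵥ kbar z')) :
    IsUnit (K + τ • (1 : Matrix (Fin n) (Fin n) ℝ)) ∧
    ∀ (m : ℕ), 1 ≤ m → ∀ (z : Fin m → Z) (c : Fin m → ℝ),
      0 ≤ ∑ i, ∑ j, c i * c j * kpost (z i) (z j) ∧
      ∑ i, ∑ j, c i * c j * kpost (z i) (z j) ≤
        ∑ i, ∑ j, c i * c j * k (z i) (z j) := by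
  obtain rfl : K = gram ℝ v := Matrix.ext hK
  have hA := posDef_gram_add_smul_one v hτ
  refine ⟨hA.isUnit, fun m _ z c => ?_⟩
  set h := ∑ i, c i • φ (z i) with hh
  set b : Fin n → ℝ := fun i => ⟪v i, h⟫_ℝ with hb
  have hprior : ∑ i, ∑ j, c i * c j * k (z i) (z j) = ⟪h, h⟫_ℝ := by
    simp only [hk, hh, sum_inner, real_inner_smul_left]
    simp only [inner_sum, real_inner_smul_right, Finset.mul_sum, mul_assoc]
  have hbsum : b = ∑ i, c i • kbar (z i) := by
    ext l
    simp [hb, hh, inner_sum, real_inner_smul_right, hkbar]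
  have hpost : ∑ i, ∑ j, c i * c j * kpost (z i) (z j) =
      ⟪h, h⟫_ℝ - b ⬝ᵥ ((gram ℝ v + τ • (1 : Matrix (Fin n) (Fin n) ℝ))⁻¹ *ᵥ b) := by
    rw [← hprior, hbsum]
    simp only [hkpost, mul_sub, Finset.sum_sub_distrib, sum_dotProduct, smul_dotProduct]
    simp only [mulVec_sum, mulVec_smul, dotProduct_sum, dotProduct_smul, smul_eq_mul,
      Finset.mul_sum, mul_assoc]
  rw [hpost, hprior]
  refine ⟨sub_nonneg.2 (dotProduct_inv_gram_add_smul_one_mulVec_le v hτ h), sub_le_self _ ?_⟩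
  simpa using hA.inv.posSemidef.dotProduct_mulVec_nonneg b
end

section
/- Let H be a real Hilbert space, let v₁, …, vₙ ∈ H, let λ > 0, and define the continuous linear operator A : H → H by A x = λ x + Σ_{i=1}^{n} ⟨vᵢ, x⟩ vᵢ. Let ζ ∈ ℝⁿ satisfy |ζᵢ| ≤ c for all i, for some c ≥ 0, and set u = Σ_{i=1}^{n} ζᵢ vᵢ. Then A is bijective with continuous inverse and ⟨u, A⁻¹ u⟩ ≤ c² n. -/
open scoped InnerProductSpace

/-- The quadratic form of the regularized covariance operator `x ↦ lam • x + ∑ i, ⟪v i, x⟫ • v i`. -/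
theorem inner_smul_add_sum_inner_smul {H ι : Type*} [NormedAddCommGroup H] [InnerProductSpace ℝ H]
    [Fintype ι] (v : ι → H) (lam : ℝ) (x : H) :
    ⟪lam • x + ∑ i, ⟪v i, x⟫_ℝ • v i, x⟫_ℝ = lam * ‖x‖ ^ 2 + ∑ i, ⟪v i, x⟫_ℝ ^ 2 := by
  simp [inner_add_left, sum_inner, real_inner_smul_left, sq]

/-- Let `H` be a real Hilbert space, `v₁, …, vₙ ∈ H`, `λ > 0`, and
`A x = λ x + ∑ i, ⟪vᵢ, x⟫ vᵢ`. If `|ζᵢ| ≤ c` for all `i` (with `c ≥ 0`) and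
`u = ∑ i, ζᵢ vᵢ`, then `A` is bijective with continuous inverse and `⟪u, A⁻¹ u⟫ ≤ c² n`. -/
theorem statement5 {H : Type*} [NormedAddCommGroup H] [InnerProductSpace ℝ H]
    [CompleteSpace H] {n : ℕ} (v : Fin n → H) (lam : ℝ) (hlam : 0 < lam)
    (A : H →L[ℝ] H) (hA : ∀ x : H, A x = lam • x + ∑ i, ⟪v i, x⟫_ℝ • v i)
    (ζ : Fin n → ℝ) (c : ℝ) (hc : 0 ≤ c) (hζ : ∀ i, |ζ i| ≤ c)
    (u : H) (hu : u = ∑ i, ζ i • v i) :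
    ∃ Ainv : H →L[ℝ] H,
      Ainv.comp A = ContinuousLinearMap.id ℝ H ∧
      A.comp Ainv = ContinuousLinearMap.id ℝ H ∧
      ⟪u, Ainv u⟫_ℝ ≤ c ^ 2 * n := by
  have hquad (x : H) : ⟪A x, x⟫_ℝ = lam * ‖x‖ ^ 2 + ∑ i, ⟪v i, x⟫_ℝ ^ 2 := by
    rw [hA, inner_smul_add_sum_inner_smul]
  have hcoer : IsCoercive ((innerSL ℝ).comp A : H →L[ℝ] H →L[ℝ] ℝ) := by
    refine ⟨lam, hlam, fun x => ?_⟩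
    have hsum : 0 ≤ ∑ i, ⟪v i, x⟫_ℝ ^ 2 := Finset.sum_nonneg fun i _ => sq_nonneg _
    calc lam * ‖x‖ * ‖x‖ = lam * ‖x‖ ^ 2 := by ring
      _ ≤ ⟪A x, x⟫_ℝ := by rw [hquad]; linarith
  let e : H ≃L[ℝ] H := hcoer.continuousLinearEquivOfBilin
  have he (x : H) : e x = A x :=
    ext_inner_right ℝ fun y => hcoer.continuousLinearEquivOfBilin_apply x y
  have hAe (x : H) : A (e.symm x) = x := by rw [← he, e.apply_symm_apply]
  refine ⟨e.symm, ?_, ?_, ?_⟩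
  · ext x
    simp [← he]
  · ext x
    simp [hAe]
  · set w : H := e.symm u with hw
    have hform : ⟪u, w⟫_ℝ = lam * ‖w‖ ^ 2 + ∑ i, ⟪v i, w⟫_ℝ ^ 2 := by
      rw [← hquad, hw, hAe]
    have hlin : ⟪u, w⟫_ℝ = ∑ i, ζ i * ⟪v i, w⟫_ℝ := by
      rw [hu, sum_inner]
      simp only [real_inner_smul_left]
    have hyoung : 2 * ∑ i, ζ i * ⟪v i, w⟫_ℝ ≤ ∑ i, (c ^ 2 + ⟪v i, w⟫_ℝ ^ 2) := by
      rw [Finset.mul_sum]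
      refine Finset.sum_le_sum fun i _ => ?_
      have hsq : ζ i ^ 2 ≤ c ^ 2 := sq_le_sq' (abs_le.mp (hζ i)).1 (abs_le.mp (hζ i)).2
      nlinarith [sq_nonneg (ζ i - ⟪v i, w⟫_ℝ)]
    have hreg : 0 ≤ lam * ‖w‖ ^ 2 := by positivity
    simp only [Finset.sum_add_distrib, Finset.sum_const, Finset.card_univ, Fintype.card_fin,
      nsmul_eq_mul] at hyoung
    change ⟪u, w⟫_ℝ ≤ c ^ 2 * n
    linarith
end

section
/- Let H be a real Hilbert space and let G, W : H → H be continuous self-adjoint linear operators such that, for some constants c > 0 and τ > 0, ⟨x, G x⟩ ≥ c ⟨x, W x⟩ for all x ∈ H and ⟨x, W x⟩ ≥ τ ‖x‖² for all x ∈ H. Then G and W are bijective with continuous inverses, and for every x ∈ H one has ‖G⁻¹ x‖² ≤ (1 / (c² τ)) · ⟨x, W⁻¹ x⟩. -/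
open scoped InnerProductSpace

/-- A coercive continuous operator on a real Hilbert space is invertible. -/
lemma ContinuousLinearMap.isUnit_of_coercive {H : Type*} [NormedAddCommGroup H]
    [InnerProductSpace ℝ H] [CompleteSpace H] (T : H →L[ℝ] H) {a : ℝ} (ha : 0 < a)
    (hT : ∀ x : H, a * ‖x‖ ^ 2 ≤ ⟪x, T x⟫_ℝ) : IsUnit T := by
  refine T.isUnit_of_forall_le_norm_inner_map (c := ⟨a, ha.le⟩) ha fun x => ?_
  rw [real_inner_comm, mul_comm]
  exact (hT x).trans (le_abs_self _)

/-- If `c T ≤ S` in the sense of quadratic forms, `T` is symmetric and nonnegative, and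
`S y = T w`, then `c² ⟪y, T y⟫ ≤ ⟪w, T w⟫`. -/
lemma ContinuousLinearMap.sq_mul_inner_le_inner_of_apply_eq {H : Type*} [NormedAddCommGroup H]
    [InnerProductSpace ℝ H] {S T : H →L[ℝ] H}
    (hTsymm : ∀ x y : H, ⟪T x, y⟫_ℝ = ⟪x, T y⟫_ℝ) (hT : ∀ x : H, 0 ≤ ⟪x, T x⟫_ℝ)
    {c : ℝ} (hc : 0 ≤ c) (hST : ∀ x : H, c * ⟪x, T x⟫_ℝ ≤ ⟪x, S x⟫_ℝ)
    {y w : H} (hyw : S y = T w) : c ^ 2 * ⟪y, T y⟫_ℝ ≤ ⟪w, T w⟫_ℝ := by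
  have hy := hST y
  rw [hyw] at hy
  have hcross : ⟪w, T y⟫_ℝ = ⟪y, T w⟫_ℝ := by rw [← hTsymm, real_inner_comm]
  have hpos := hT (c • y - w)
  simp only [map_sub, map_smul, inner_sub_left, inner_sub_right, real_inner_smul_left,
    real_inner_smul_right, hcross] at hpos
  nlinarith [mul_le_mul_of_nonneg_left hy hc]

/-- Let `G, W` be continuous self-adjoint operators on a real Hilbert
space with `⟪x, G x⟫ ≥ c ⟪x, W x⟫` and `⟪x, W x⟫ ≥ τ ‖x‖²` for all `x`, where `c, τ > 0`.
Then `G` and `W` are bijective with continuous inverses and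
`‖G⁻¹ x‖² ≤ (1 / (c² τ)) ⟪x, W⁻¹ x⟫` for every `x`. -/
theorem statement6 {H : Type*} [NormedAddCommGroup H] [InnerProductSpace ℝ H]
    [CompleteSpace H] (G W : H →L[ℝ] H)
    (hGsa : ∀ x y : H, ⟪G x, y⟫_ℝ = ⟪x, G y⟫_ℝ)
    (hWsa : ∀ x y : H, ⟪W x, y⟫_ℝ = ⟪x, W y⟫_ℝ)
    (c τ : ℝ) (hc : 0 < c) (hτ : 0 < τ)
    (hGW : ∀ x : H, c * ⟪x, W x⟫_ℝ ≤ ⟪x, G x⟫_ℝ)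
    (hWcoer : ∀ x : H, τ * ‖x‖ ^ 2 ≤ ⟪x, W x⟫_ℝ) :
    ∃ (Ginv Winv : H →L[ℝ] H),
      Ginv.comp G = ContinuousLinearMap.id ℝ H ∧
      G.comp Ginv = ContinuousLinearMap.id ℝ H ∧
      Winv.comp W = ContinuousLinearMap.id ℝ H ∧
      W.comp Winv = ContinuousLinearMap.id ℝ H ∧
      ∀ x : H, ‖Ginv x‖ ^ 2 ≤ (1 / (c ^ 2 * τ)) * ⟪x, Winv x⟫_ℝ := by
  have hGcoer : ∀ x : H, (c * τ) * ‖x‖ ^ 2 ≤ ⟪x, G x⟫_ℝ := fun x => by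
    rw [mul_assoc]
    exact (mul_le_mul_of_nonneg_left (hWcoer x) hc.le).trans (hGW x)
  obtain ⟨G, rfl⟩ := G.isUnit_of_coercive (mul_pos hc hτ) hGcoer
  obtain ⟨W, rfl⟩ := W.isUnit_of_coercive hτ hWcoer
  refine ⟨↑G⁻¹, ↑W⁻¹, G.inv_mul, G.mul_inv, W.inv_mul, W.mul_inv, fun x => ?_⟩
  set y := (↑G⁻¹ : H →L[ℝ] H) x
  set w := (↑W⁻¹ : H →L[ℝ] H) x
  have hGy : (G : H →L[ℝ] H) y = x := DFunLike.congr_fun G.mul_inv x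
  have hWw : (W : H →L[ℝ] H) w = x := DFunLike.congr_fun W.mul_inv x
  have hle := ContinuousLinearMap.sq_mul_inner_le_inner_of_apply_eq hWsa
    (fun z => (by positivity : 0 ≤ τ * ‖z‖ ^ 2).trans (hWcoer z)) hc.le hGW
    (hGy.trans hWw.symm)
  rw [hWw, real_inner_comm x w] at hle
  rw [one_div_mul_eq_div, le_div_iff₀ (by positivity)]
  nlinarith [mul_le_mul_of_nonneg_left (hWcoer y) (sq_nonneg c)]
end

section
/- Let H be a real Hilbert space and let W : H → H be a continuous self-adjoint linear operator such that τ ‖x‖² ≤ ⟨x, W x⟩ ≤ M ‖x‖² for all x ∈ H, where 0 < τ ≤ M. Let S : H → H be a continuous self-adjoint linear operator with ⟨x, S x⟩ ≥ 0 for all x and S ∘ S = W⁻¹. Then for all unit vectors x, y ∈ H (‖x‖ = ‖y‖ = 1), the vectors S x and S y are nonzero and ‖ (S x)/‖S x‖ − (S y)/‖S y‖ ‖ ≤ 2 √(M/τ) · ‖x − y‖. -/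
open scoped InnerProductSpace

/-- Normalization is Lipschitz with constant `2 / ‖u‖` away from the origin. -/
theorem norm_mul_norm_normalize_sub_le {E : Type*} [NormedAddCommGroup E] [NormedSpace ℝ E]
    {u v : E} (hu : u ≠ 0) (hv : v ≠ 0) :
    ‖u‖ * ‖‖u‖⁻¹ • u - ‖v‖⁻¹ • v‖ ≤ 2 * ‖u - v‖ := by
  have hu' : ‖u‖ ≠ 0 := norm_ne_zero_iff.2 hu
  have hv' : ‖v‖ ≠ 0 := norm_ne_zero_iff.2 hv
  have split : ‖u‖ • (‖u‖⁻¹ • u - ‖v‖⁻¹ • v) = (u - v) - ((‖u‖ - ‖v‖) * ‖v‖⁻¹) • v := by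
    rw [smul_sub, smul_inv_smul₀ hu', sub_mul, mul_inv_cancel₀ hv', sub_smul, one_smul, smul_smul]
    abel
  have radial : ‖((‖u‖ - ‖v‖) * ‖v‖⁻¹) • v‖ = |‖u‖ - ‖v‖| := by
    rw [norm_smul, norm_mul, norm_inv, norm_norm, inv_mul_cancel_right₀ hv', Real.norm_eq_abs]
  calc ‖u‖ * ‖‖u‖⁻¹ • u - ‖v‖⁻¹ • v‖
      = ‖(u - v) - ((‖u‖ - ‖v‖) * ‖v‖⁻¹) • v‖ := by rw [← split, norm_smul, norm_norm]
    _ ≤ ‖u - v‖ + |‖u‖ - ‖v‖| := radial ▸ norm_sub_le _ _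
    _ ≤ 2 * ‖u - v‖ := by linarith [abs_norm_sub_norm_le u v]

/-- Let `W` be a continuous self-adjoint operator on a real Hilbert space
with `τ ‖x‖² ≤ ⟪x, W x⟫ ≤ M ‖x‖²` for all `x`, `0 < τ ≤ M`, with continuous inverse
`W⁻¹`, and let `S` be a continuous self-adjoint positive operator with `S ∘ S = W⁻¹`
(i.e. `S = W^{-1/2}`). Then for all unit vectors `x, y`, the vectors `S x, S y` are
nonzero and `‖(S x)/‖S x‖ − (S y)/‖S y‖‖ ≤ 2 √(M/τ) ‖x − y‖`. -/
theorem statement9 {H : Type*} [NormedAddCommGroup H] [InnerProductSpace ℝ H]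
    [CompleteSpace H] (W Winv S : H →L[ℝ] H)
    (τ M : ℝ) (hτ : 0 < τ) (hτM : τ ≤ M)
    (hWsa : ∀ x y : H, ⟪W x, y⟫_ℝ = ⟪x, W y⟫_ℝ)
    (hlower : ∀ x : H, τ * ‖x‖ ^ 2 ≤ ⟪x, W x⟫_ℝ)
    (hupper : ∀ x : H, ⟪x, W x⟫_ℝ ≤ M * ‖x‖ ^ 2)
    (hinv₁ : Winv.comp W = ContinuousLinearMap.id ℝ H)
    (hinv₂ : W.comp Winv = ContinuousLinearMap.id ℝ H)
    (hSsa : ∀ x y : H, ⟪S x, y⟫_ℝ = ⟪x, S y⟫_ℝ)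
    (hSpos : ∀ x : H, 0 ≤ ⟪x, S x⟫_ℝ)
    (hSS : S.comp S = Winv) :
    ∀ x y : H, ‖x‖ = 1 → ‖y‖ = 1 →
      S x ≠ 0 ∧ S y ≠ 0 ∧
      ‖‖S x‖⁻¹ • S x - ‖S y‖⁻¹ • S y‖ ≤ 2 * Real.sqrt (M / τ) * ‖x - y‖ := by
  have hWSS (x : H) : W (S (S x)) = x := by
    simpa [← hSS] using DFunLike.congr_fun hinv₂ x
  have hSSW (x : H) : S (S (W x)) = x := by
    simpa [← hSS] using DFunLike.congr_fun hinv₁ x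
  have hSWS (x : H) : S (W (S x)) = x := by
    calc S (W (S x)) = W (S (S (S (W (S x))))) := (hWSS _).symm
      _ = x := by rw [hSSW, hWSS]
  have energy (x : H) : ⟪S x, W (S x)⟫_ℝ = ‖x‖ ^ 2 := by
    rw [hSsa, hSWS, real_inner_self_eq_norm_sq]
  have hM : 0 < M := hτ.trans_le hτM
  have norm_le (x : H) : ‖x‖ ≤ √M * ‖S x‖ := by
    rw [← Real.sqrt_sq (norm_nonneg (S x)), ← Real.sqrt_mul hM.le]
    exact Real.le_sqrt_of_sq_le (energy x ▸ hupper (S x))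
  have le_norm (x : H) : √τ * ‖S x‖ ≤ ‖x‖ := by
    rw [← Real.sqrt_sq (norm_nonneg (S x)), ← Real.sqrt_mul hτ.le]
    exact Real.sqrt_le_iff.2 ⟨norm_nonneg x, energy x ▸ hlower (S x)⟩
  have ne_zero (x : H) (hx : ‖x‖ = 1) : S x ≠ 0 := by
    intro h
    have := norm_le x
    rw [h, hx, norm_zero, mul_zero] at this
    linarith
  intro x y hx hy
  refine ⟨ne_zero x hx, ne_zero y hy, ?_⟩
  set d := ‖‖S x‖⁻¹ • S x - ‖S y‖⁻¹ • S y‖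
  have hsub : √τ * ‖S x - S y‖ ≤ ‖x - y‖ := by simpa using le_norm (x - y)
  have hd : d ≤ √M * (2 * ‖S x - S y‖) :=
    calc d = ‖x‖ * d := by rw [hx, one_mul]
      _ ≤ √M * ‖S x‖ * d := by gcongr; exact norm_le x
      _ = √M * (‖S x‖ * d) := mul_assoc _ _ _
      _ ≤ √M * (2 * ‖S x - S y‖) :=
        mul_le_mul_of_nonneg_left
          (norm_mul_norm_normalize_sub_le (ne_zero x hx) (ne_zero y hy)) (Real.sqrt_nonneg M)
  rw [Real.sqrt_div hM.le, mul_div_assoc', div_mul_eq_mul_div, le_div_iff₀ (Real.sqrt_pos.2 hτ)]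
  calc d * √τ ≤ √M * (2 * ‖S x - S y‖) * √τ := by gcongr
    _ = 2 * √M * (√τ * ‖S x - S y‖) := by ring
    _ ≤ 2 * √M * ‖x - y‖ := by gcongr
end

section
/- Let H be a real Hilbert space, let Z ⊆ ℝ^d, and let φ : Z → H satisfy ‖φ(z) − φ(z')‖ ≤ L ‖z − z'‖₂^α for all z, z' ∈ Z, where L > 0 and 0 < α ≤ 1. Let r ∈ H, let β ≥ 0, and let B : H → H be a continuous self-adjoint λ-coercive linear operator with λ > 0 and continuous inverse B⁻¹. Define f : Z → ℝ by f(z) = ⟨φ(z), r⟩ + β √(⟨φ(z), B⁻¹ φ(z)⟩). Then for all z, z' ∈ Z one has |f(z) − f(z')| ≤ (‖r‖ + β/√λ) · L ‖z − z'‖₂^α. -/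
open scoped InnerProductSpace

section PositiveOperator

variable {H : Type*} [NormedAddCommGroup H] [InnerProductSpace ℝ H]

/-- Cauchy–Schwarz inequality for the form `⟪x, T y⟫` of a positive symmetric operator `T`. -/
theorem inner_map_le_sqrt_mul_sqrt {T : H →L[ℝ] H}
    (hsymm : ∀ x y : H, ⟪T x, y⟫_ℝ = ⟪x, T y⟫_ℝ) (hpos : ∀ x : H, 0 ≤ ⟪x, T x⟫_ℝ) (x y : H) :
    ⟪x, T y⟫_ℝ ≤ √⟪x, T x⟫_ℝ * √⟪y, T y⟫_ℝ := by
  have hcomm : ⟪y, T x⟫_ℝ = ⟪x, T y⟫_ℝ := by rw [← hsymm, real_inner_comm]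
  have hdiscrim : discrim ⟪y, T y⟫_ℝ (2 * ⟪x, T y⟫_ℝ) ⟪x, T x⟫_ℝ ≤ 0 := by
    refine discrim_le_zero fun t => ?_
    have h := hpos (x + t • y)
    simp only [map_add, map_smul, inner_add_left, inner_add_right, real_inner_smul_left,
      real_inner_smul_right, hcomm] at h
    linarith
  rw [← Real.sqrt_mul (hpos x)]
  refine Real.le_sqrt_of_sq_le ?_
  rw [discrim] at hdiscrim
  linarith

/-- Triangle inequality for the seminorm `√⟪x, T x⟫` of a positive symmetric operator `T`. -/
theorem sqrt_inner_map_add_le {T : H →L[ℝ] H}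
    (hsymm : ∀ x y : H, ⟪T x, y⟫_ℝ = ⟪x, T y⟫_ℝ) (hpos : ∀ x : H, 0 ≤ ⟪x, T x⟫_ℝ) (x y : H) :
    √⟪x + y, T (x + y)⟫_ℝ ≤ √⟪x, T x⟫_ℝ + √⟪y, T y⟫_ℝ := by
  have hcomm : ⟪y, T x⟫_ℝ = ⟪x, T y⟫_ℝ := by rw [← hsymm, real_inner_comm]
  refine Real.sqrt_le_iff.2 ⟨by positivity, ?_⟩
  have hcs := inner_map_le_sqrt_mul_sqrt hsymm hpos x y
  have hx := Real.sq_sqrt (hpos x)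
  have hy := Real.sq_sqrt (hpos y)
  simp only [map_add, inner_add_left, inner_add_right, hcomm]
  linarith [add_sq √⟪x, T x⟫_ℝ √⟪y, T y⟫_ℝ]

/-- Reverse triangle inequality for the seminorm `√⟪x, T x⟫`. -/
theorem abs_sqrt_inner_map_sub_le {T : H →L[ℝ] H}
    (hsymm : ∀ x y : H, ⟪T x, y⟫_ℝ = ⟪x, T y⟫_ℝ) (hpos : ∀ x : H, 0 ≤ ⟪x, T x⟫_ℝ) (x y : H) :
    |√⟪x, T x⟫_ℝ - √⟪y, T y⟫_ℝ| ≤ √⟪x - y, T (x - y)⟫_ℝ := by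
  have hxy := sqrt_inner_map_add_le hsymm hpos (x - y) y
  have hyx := sqrt_inner_map_add_le hsymm hpos (y - x) x
  have hneg : ⟪y - x, T (y - x)⟫_ℝ = ⟪x - y, T (x - y)⟫_ℝ := by
    rw [← neg_sub x y, map_neg, inner_neg_neg]
  rw [sub_add_cancel] at hxy hyx
  rw [hneg] at hyx
  exact abs_sub_le_iff.2 ⟨by linarith, by linarith⟩

/-- A right inverse `T` of a `c`-coercive operator satisfies `√⟪x, T x⟫ ≤ ‖x‖ / √c`. -/
theorem sqrt_inner_rightInverse_le {B T : H →L[ℝ] H} {c : ℝ} (hc : 0 < c)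
    (hcoer : ∀ x : H, c * ‖x‖ ^ 2 ≤ ⟪x, B x⟫_ℝ) (hBT : ∀ x, B (T x) = x) (x : H) :
    √⟪x, T x⟫_ℝ ≤ ‖x‖ / √c := by
  have hle : c * ‖T x‖ ^ 2 ≤ ⟪x, T x⟫_ℝ := by
    simpa only [hBT, real_inner_comm] using hcoer (T x)
  have hcs := real_inner_le_norm x (T x)
  refine Real.sqrt_le_iff.2 ⟨by positivity, ?_⟩
  rw [div_pow, Real.sq_sqrt hc.le, le_div_iff₀ hc]
  nlinarith [sq_nonneg (‖x‖ - c * ‖T x‖)]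

end PositiveOperator

/-- Let `φ : Z → H` (with `Z ⊆ ℝ^d`) be `α`-Hölder with constant `L`
(`L > 0`, `0 < α ≤ 1`), let `r ∈ H`, `β ≥ 0`, and let `B` be a continuous self-adjoint
`λ`-coercive operator (`λ > 0`) with continuous inverse `B⁻¹`. Then
`f(z) = ⟪φ(z), r⟫ + β √⟪φ(z), B⁻¹ φ(z)⟫` satisfies
`|f(z) − f(z')| ≤ (‖r‖ + β/√λ) L ‖z − z'‖₂^α` on `Z`. -/
theorem statement11 {H : Type*} [NormedAddCommGroup H] [InnerProductSpace ℝ H]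
    [CompleteSpace H] {d : ℕ} (Z : Set (EuclideanSpace ℝ (Fin d)))
    (φ : EuclideanSpace ℝ (Fin d) → H)
    (L α : ℝ) (hL : 0 < L) (hα : 0 < α) (hα1 : α ≤ 1)
    (hφ : ∀ z ∈ Z, ∀ z' ∈ Z, ‖φ z - φ z'‖ ≤ L * ‖z - z'‖ ^ α)
    (r : H) (β : ℝ) (hβ : 0 ≤ β)
    (B Binv : H →L[ℝ] H)
    (hsa : ∀ x y : H, ⟪B x, y⟫_ℝ = ⟪x, B y⟫_ℝ)
    (lam : ℝ) (hlam : 0 < lam) (hcoer : ∀ x : H, lam * ‖x‖ ^ 2 ≤ ⟪x, B x⟫_ℝ)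
    (hinv₁ : Binv.comp B = ContinuousLinearMap.id ℝ H)
    (hinv₂ : B.comp Binv = ContinuousLinearMap.id ℝ H)
    (f : EuclideanSpace ℝ (Fin d) → ℝ)
    (hf : ∀ z, f z = ⟪φ z, r⟫_ℝ + β * Real.sqrt ⟪φ z, Binv (φ z)⟫_ℝ) :
    ∀ z ∈ Z, ∀ z' ∈ Z,
      |f z - f z'| ≤ (‖r‖ + β / Real.sqrt lam) * L * ‖z - z'‖ ^ α := by
  have hBT : ∀ x, B (Binv x) = x := fun x => DFunLike.congr_fun hinv₂ x
  have hsymm : ∀ x y : H, ⟪Binv x, y⟫_ℝ = ⟪x, Binv y⟫_ℝ := fun x y => by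
    simpa only [hBT] using (hsa (Binv x) (Binv y)).symm
  have hpos : ∀ x : H, 0 ≤ ⟪x, Binv x⟫_ℝ := fun x => by
    have h : lam * ‖Binv x‖ ^ 2 ≤ ⟪x, Binv x⟫_ℝ := by
      simpa only [hBT, real_inner_comm] using hcoer (Binv x)
    exact le_trans (by positivity) h
  intro z hz z' hz'
  calc |f z - f z'|
      = |⟪φ z - φ z', r⟫_ℝ + β * (√⟪φ z, Binv (φ z)⟫_ℝ - √⟪φ z', Binv (φ z')⟫_ℝ)| := by
        rw [hf, hf, inner_sub_left]
        ring_nf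
    _ ≤ |⟪φ z - φ z', r⟫_ℝ| + β * |√⟪φ z, Binv (φ z)⟫_ℝ - √⟪φ z', Binv (φ z')⟫_ℝ| := by
        refine (abs_add_le _ _).trans_eq ?_
        rw [abs_mul, abs_of_nonneg hβ]
    _ ≤ ‖φ z - φ z'‖ * ‖r‖ + β * (‖φ z - φ z'‖ / √lam) := by
        gcongr
        · exact abs_real_inner_le_norm _ _
        · exact (abs_sqrt_inner_map_sub_le hsymm hpos _ _).trans
            (sqrt_inner_rightInverse_le hlam hcoer hBT _)
    _ = (‖r‖ + β / √lam) * ‖φ z - φ z'‖ := by ring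
    _ ≤ (‖r‖ + β / √lam) * (L * ‖z - z'‖ ^ α) := by
        gcongr
        exact hφ z hz z' hz'
    _ = (‖r‖ + β / √lam) * L * ‖z - z'‖ ^ α := by ring
end
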